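/- For every integer m ≥ 3 and every integer n ≥ 6, the set S([n]_{2^m}, 6) = { S(j,6) : j ∈ [n]_{2^m} } is constant modulo 2^(m−1) but is not constant modulo 2^m. -/

import Mathlib

/-- Stirling numbers of the second kind, via the standard recurrence. -/
def stirling2 : ℕ → ℕ → ℕ
  | 0, 0 => 1
  | 0, _ + 1 => 0
  | _ + 1, 0 => 0
  | n + 1, k + 1 => (k + 1) * stirling2 n (k + 1) + stirling2 n k

/-- The congruence class `[n]_t = { j : j ≥ max(n,t) and j ≡ n (mod t) }`. -/
def cls (n t : ℕ) : Set ℕ := {j | max n t ≤ j ∧ j ≡ n [MOD t]}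

/-- `b_k = ⌈log₂ k⌉ - 2`. -/
def bk (k : ℕ) : ℕ := Nat.clog 2 k - 2

/-- A set of naturals is constant modulo `M`. -/
def ConstMod (M : ℕ) (A : Set ℕ) : Prop := ∀ a ∈ A, ∀ b ∈ A, a ≡ b [MOD M]

/-- The image set `S([n]_{2^m}, k)`. -/
def Scls (k n m : ℕ) : Set ℕ := (fun j => stirling2 j k) '' cls n (2 ^ m)

/-- The function `j ↦ ν₂(S(j,k))` is constant on the set `A`. -/
def ValConstOn (k : ℕ) (A : Set ℕ) : Prop :=
  ∀ i ∈ A, ∀ j ∈ A, padicValNat 2 (stirling2 i k) = padicValNat 2 (stirling2 j k)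

/-- `N_{k,m}`: the set of `n` with `k ≤ n < k + 2^m` on which `ν₂ ∘ S(·,k)`
is non-constant on `[n]_{2^m}`. -/
def Nkm (k m : ℕ) : Set ℕ :=
  {n | k ≤ n ∧ n < k + 2 ^ m ∧ ¬ ValConstOn k (cls n (2 ^ m))}

theorem stirling2_closed_forms (n : ℕ) :
    (stirling2 (n + 1) 0 : ℤ) = 0 ∧
    (stirling2 (n + 1) 1 : ℤ) = 1 ∧
    2 * (stirling2 (n + 1) 2 : ℤ) = 2 ^ (n + 1) - 2 ∧
    6 * (stirling2 (n + 1) 3 : ℤ) = 3 ^ (n + 1) - 3 * 2 ^ (n + 1) + 3 ∧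
    24 * (stirling2 (n + 1) 4 : ℤ) = 4 ^ (n + 1) - 4 * 3 ^ (n + 1) + 6 * 2 ^ (n + 1) - 4 ∧
    120 * (stirling2 (n + 1) 5 : ℤ) =
      5 ^ (n + 1) - 5 * 4 ^ (n + 1) + 10 * 3 ^ (n + 1) - 10 * 2 ^ (n + 1) + 5 ∧
    720 * (stirling2 (n + 1) 6 : ℤ) = 6 ^ (n + 1) - 6 * 5 ^ (n + 1) + 15 * 4 ^ (n + 1)
      - 20 * 3 ^ (n + 1) + 15 * 2 ^ (n + 1) - 6 := by
  induction n with
  | zero => simp [stirling2]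
  | succ n ih =>
    obtain ⟨h0, h1, h2, h3, h4, h5, h6⟩ := ih
    have hrec (k : ℕ) : (stirling2 (n + 1 + 1) (k + 1) : ℤ) =
        (k + 1) * stirling2 (n + 1) (k + 1) + stirling2 (n + 1) k := by
      simp [stirling2.eq_4]
    have r1 := hrec 0
    have r2 := hrec 1
    have r3 := hrec 2
    have r4 := hrec 3
    have r5 := hrec 4
    have r6 := hrec 5
    norm_num at r1 r2 r3 r4 r5 r6
    simp only [pow_succ _ (n + 1)]
    refine ⟨by simp [stirling2], ?_, ?_, ?_, ?_, ?_, ?_⟩ <;> linarith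

theorem five_pow_two_pow (m : ℕ) : ∃ c : ℤ, (5 : ℤ) ^ 2 ^ m = 1 + 2 ^ (m + 2) * (2 * c + 1) := by
  induction m with
  | zero => exact ⟨0, by norm_num⟩
  | succ m ih =>
    obtain ⟨c, hc⟩ := ih
    refine ⟨c + 2 ^ m * (2 * c + 1) ^ 2, ?_⟩
    rw [pow_succ 2 m, pow_mul, hc]
    ring

theorem three_pow_two_pow_succ (m : ℕ) :
    ∃ c : ℤ, (3 : ℤ) ^ 2 ^ (m + 1) = 1 + 2 ^ (m + 3) * c := by
  induction m with
  | zero => exact ⟨1, by norm_num⟩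
  | succ m ih =>
    obtain ⟨c, hc⟩ := ih
    refine ⟨c + 2 ^ (m + 2) * c ^ 2, ?_⟩
    rw [pow_succ 2 (m + 1), pow_mul, hc]
    ring

theorem add_five_le_two_pow_succ (p : ℕ) (hp : 2 ≤ p) : p + 5 ≤ 2 ^ (p + 1) := by
  induction p, hp using Nat.le_induction with
  | base => norm_num
  | succ p _ ih => rw [pow_succ]; omega

theorem stirling2_six_add_two_pow (p j : ℕ) (hp : 2 ≤ p) (hj : 2 ^ (p + 1) ≤ j) :
    ∃ e : ℤ, (stirling2 (j + 2 ^ (p + 1)) 6 : ℤ) = stirling2 j 6 + 2 ^ p * (2 * e + 1) := by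
  have hpj : p + 5 ≤ j := (add_five_le_two_pow_succ p hp).trans hj
  have closed (i : ℕ) (hi : 1 ≤ i) : 720 * (stirling2 i 6 : ℤ) =
      6 ^ i - 6 * 5 ^ i + 15 * 4 ^ i - 20 * 3 ^ i + 15 * 2 ^ i - 6 := by
    obtain ⟨i, rfl⟩ := Nat.exists_eq_add_of_le' hi
    exact (stirling2_closed_forms i).2.2.2.2.2.2
  have even_pow (a : ℤ) (i : ℕ) (hi : j ≤ i) : ∃ b, (2 * a) ^ i = 2 ^ (p + 5) * b :=
    (pow_dvd_pow 2 (hpj.trans hi)).trans (pow_dvd_pow_of_dvd (dvd_mul_right 2 a) i)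
  obtain ⟨a1, ha1⟩ := even_pow 1 j le_rfl
  obtain ⟨a2, ha2⟩ := even_pow 2 j le_rfl
  obtain ⟨a3, ha3⟩ := even_pow 3 j le_rfl
  obtain ⟨b1, hb1⟩ := even_pow 1 (j + 2 ^ (p + 1)) (Nat.le_add_right _ _)
  obtain ⟨b2, hb2⟩ := even_pow 2 (j + 2 ^ (p + 1)) (Nat.le_add_right _ _)
  obtain ⟨b3, hb3⟩ := even_pow 3 (j + 2 ^ (p + 1)) (Nat.le_add_right _ _)
  norm_num only at ha1 ha2 ha3 hb1 hb2 hb3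
  obtain ⟨c, hc⟩ := five_pow_two_pow (p + 1)
  obtain ⟨d, hd⟩ := three_pow_two_pow_succ p
  obtain ⟨f, hf⟩ : Odd ((5 : ℤ) ^ j) := Odd.pow (by decide)
  have h0 := closed j (by omega)
  have h1 := closed (j + 2 ^ (p + 1)) (Nat.le_add_right_of_le (by omega))
  rw [ha1, ha2, ha3] at h0
  rw [hb1, hb2, hb3, pow_add 5, pow_add 3, hc, hd, hf] at h1
  rw [hf] at h0
  obtain ⟨q, hq⟩ : ∃ q : ℤ, 45 * ((stirling2 (j + 2 ^ (p + 1)) 6 : ℤ) - stirling2 j 6) =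
      2 ^ p * (2 * q + 1) := by
    refine ⟨b3 - a3 + 15 * (b2 - a2) + 15 * (b1 - a1) - 5 * 3 ^ j * d
      - 3 * (2 * f * c + f + c) - 2, ?_⟩
    generalize stirling2 (j + 2 ^ (p + 1)) 6 = s at h1 ⊢
    simp only [pow_add] at h0 h1
    linarith
  have hdvd : (2 : ℤ) ^ p ∣ (stirling2 (j + 2 ^ (p + 1)) 6 : ℤ) - stirling2 j 6 := by
    have hcop : IsCoprime ((2 : ℤ) ^ p) 45 := IsCoprime.pow_left ⟨-22, 1, by norm_num⟩
    exact hcop.dvd_of_dvd_mul_left ⟨_, hq⟩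
  obtain ⟨g, hg⟩ := hdvd
  have hg' : 45 * g = 2 * q + 1 := by
    apply mul_left_cancel₀ (pow_ne_zero p (two_ne_zero (α := ℤ)))
    rw [← hq, hg]
    ring
  refine ⟨g / 2, ?_⟩
  have : 2 * (g / 2) + 1 = g := by omega
  rw [this]
  linarith

theorem stirling2_six_add_mul_modEq (p j t : ℕ) (hp : 2 ≤ p) (hj : 2 ^ (p + 1) ≤ j) :
    stirling2 (j + 2 ^ (p + 1) * t) 6 ≡ stirling2 j 6 [MOD 2 ^ p] := by
  induction t with
  | zero => rfl
  | succ t ih =>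
    refine Nat.ModEq.trans ?_ ih
    obtain ⟨e, he⟩ := stirling2_six_add_two_pow p (j + 2 ^ (p + 1) * t) hp (by omega)
    rw [mul_add_one, ← add_assoc]
    apply Nat.ModEq.symm
    rw [Nat.modEq_iff_dvd]
    exact ⟨2 * e + 1, by push_cast; rw [he]; ring⟩

theorem k6_const_levels (m n : ℕ) (hm : 3 ≤ m) (hn : 6 ≤ n) :
    ConstMod (2 ^ (m - 1)) (Scls 6 n m) ∧ ¬ ConstMod (2 ^ m) (Scls 6 n m) := by
  obtain ⟨p, rfl⟩ := Nat.exists_eq_add_of_le' (show 1 ≤ m by omega)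
  have hp : 2 ≤ p := by omega
  rw [Nat.add_sub_cancel]
  constructor
  · have key (i j : ℕ) (hi : i ∈ cls n (2 ^ (p + 1))) (hj : j ∈ cls n (2 ^ (p + 1)))
        (hij : i ≤ j) : stirling2 j 6 ≡ stirling2 i 6 [MOD 2 ^ p] := by
      obtain ⟨t, ht⟩ := (Nat.modEq_iff_dvd' hij).mp (hi.2.trans hj.2.symm)
      obtain rfl : j = i + 2 ^ (p + 1) * t := by omega
      exact stirling2_six_add_mul_modEq p i t hp ((le_max_right _ _).trans hi.1)
    rintro _ ⟨i, hi, rfl⟩ _ ⟨j, hj, rfl⟩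
    rcases le_total i j with hij | hij
    · exact (key i j hi hj hij).symm
    · exact key j i hj hi hij
  · intro h
    have hpos : 0 < 2 ^ (p + 1) := by positivity
    have hle : n ≤ 2 ^ (p + 1) * n := Nat.le_mul_of_pos_left n hpos
    have hge : 2 ^ (p + 1) ≤ 2 ^ (p + 1) * n := Nat.le_mul_of_pos_right _ (by omega)
    set j := n + 2 ^ (p + 1) * n with hj
    have hjn : j ≡ n [MOD 2 ^ (p + 1)] := by simp [hj, Nat.ModEq]
    have hmem : j ∈ cls n (2 ^ (p + 1)) := ⟨max_le (by omega) (by omega), hjn⟩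
    have hmem' : j + 2 ^ (p + 1) ∈ cls n (2 ^ (p + 1)) :=
      ⟨max_le (by omega) (by omega), by simpa [Nat.ModEq] using hjn⟩
    have hmod := h _ ⟨j, hmem, rfl⟩ _ ⟨_, hmem', rfl⟩
    obtain ⟨e, he⟩ := stirling2_six_add_two_pow p j hp (by omega)
    obtain ⟨c, hc⟩ := Nat.modEq_iff_dvd.mp hmod
    simp only [he] at hc
    push_cast at hc
    have : 2 * e + 1 = 2 * c := by
      apply mul_left_cancel₀ (pow_ne_zero p (two_ne_zero (α := ℤ)))
      rw [pow_succ] at hc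
      linarith
    omega
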